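/- Let Q be a set equipped with a preorder ≤, let D ⊆ Q be dense for ≤ (for every s ∈ Q there is p ∈ D with s ≤ p), and let R be a symmetric binary relation on Q such that R p q implies p ∈ D and q ∈ D, and such that the following extension property holds: whenever R p q and p ≤ p′, there exist p″ and q″ with p′ ≤ p″, q ≤ q″, and R p″ q″. Define p → q to mean that there is a finite sequence p = r₀, r₁, …, r_{m−1} = q such that for each k < m−1 either r_k ≤ r_{k+1} or R r_k r_{k+1}. Let E ⊆ D be →-open within D (if q ∈ E, q → r, and r ∈ D, then r ∈ E) and →-dense in D (for every p ∈ D there is q ∈ E with p → q). Then E is dense in (Q, ≤): for every s ∈ Q there exists p′ ∈ E with s ≤ p′. -/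

import Mathlib

/-- `chainArrow le R p q` : there is a finite sequence `p = r 0, …, r (m-1) = q`
such that each consecutive pair is related by `le` or by `R`
(Definition 4.4 of the paper). -/
def chainArrow {Q : Type*} (le R : Q → Q → Prop) (p q : Q) : Prop :=
  ∃ (m : ℕ) (r : ℕ → Q), 0 < m ∧ r 0 = p ∧ r (m - 1) = q ∧
    ∀ k : ℕ, k + 1 < m → (le (r k) (r (k + 1)) ∨ R (r k) (r (k + 1)))

theorem chainArrow.reflTransGen {Q : Type*} {le R : Q → Q → Prop} {p q : Q}
    (h : chainArrow le R p q) : Relation.ReflTransGen (fun a b => le a b ∨ R a b) p q := by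
  obtain ⟨m, r, -, rfl, rfl, hstep⟩ := h
  have reach : ∀ k, k ≤ m - 1 → Relation.ReflTransGen (fun a b => le a b ∨ R a b) (r 0) (r k) := by
    intro k
    induction k with
    | zero => exact fun _ => .refl
    | succ k ih => exact fun hk => (ih (by omega)).tail (hstep k (by omega))
  exact reach (m - 1) le_rfl

theorem chainArrow.single {Q : Type*} {le R : Q → Q → Prop} {p q : Q}
    (h : le p q ∨ R p q) : chainArrow le R p q := by
  refine ⟨2, fun k => if k = 0 then p else q, by omega, by simp, by simp, fun k hk => ?_⟩
  obtain rfl : k = 0 := by omega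
  simpa using h

/-- Abstract content of Lemma 4.5: if `D` is `≤`-dense in `Q` and `E ⊆ D` is
`→`-open within `D` and `→`-dense in `D`, then `E` is `≤`-dense in `Q`. -/
theorem stmt_5 {Q : Type*} [Preorder Q] (D : Set Q) (R : Q → Q → Prop)
    (hDdense : ∀ s : Q, ∃ p ∈ D, s ≤ p)
    (hsymm : ∀ p q, R p q → R q p)
    (hdom : ∀ p q, R p q → p ∈ D ∧ q ∈ D)
    (hext : ∀ p q p', R p q → p ≤ p' →
      ∃ p'' q'', p' ≤ p'' ∧ q ≤ q'' ∧ R p'' q'')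
    (E : Set Q) (hED : E ⊆ D)
    (hopen : ∀ q ∈ E, ∀ r ∈ D, chainArrow (· ≤ ·) R q r → r ∈ E)
    (hEdense : ∀ p ∈ D, ∃ q ∈ E, chainArrow (· ≤ ·) R p q)
    (s : Q) :
    ∃ p' ∈ E, s ≤ p' := by
  obtain ⟨p, hpD, hsp⟩ := hDdense s
  obtain ⟨q, hqE, hpq⟩ := hEdense p hpD
  suffices ∃ p' ∈ E, p ≤ p' from this.imp fun _ h => ⟨h.1, hsp.trans h.2⟩
  replace hpq := hpq.reflTransGen
  clear hpD hsp
  induction hpq using Relation.ReflTransGen.head_induction_on with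
  | refl => exact ⟨q, hqE, le_rfl⟩
  | @head a b hab _ ih =>
    obtain ⟨b', hb'E, hbb'⟩ := ih
    rcases hab with hab | hab
    · exact ⟨b', hb'E, le_trans hab hbb'⟩
    · obtain ⟨b'', a'', hb'', haa'', hR⟩ := hext b a b' (hsymm a b hab) hbb'
      obtain ⟨hb''D, ha''D⟩ := hdom b'' a'' hR
      have hb''E := hopen b' hb'E b'' hb''D (.single (.inl hb''))
      exact ⟨a'', hopen b'' hb''E a'' ha''D (.single (.inr hR)), haa''⟩
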